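/- Let B be a prime signed chord diagram on n ≥ 2 chords, i.e. one whose intersection graph I(B) is connected. Then f(B) = n if and only if every pair of distinct chords of B is interlaced and every chord of B has sign −1 (equivalently, B has signed rotation [e₁, e₂, …, e_n, −e₁, −e₂, …, −e_n]). -/

import Mathlib

open Finset Polynomial

/-- A signed chord diagram (bouquet) on a finite chord set `E` with `n` chords:
the `2*n` cyclic positions are labeled by chords via `chord`, each chord occupying
exactly two positions, and each chord carries a sign (`true` = `+1` = untwisted,
`false` = `-1` = twisted). -/
structure Bouquet (n : ℕ) (E : Type) [Fintype E] [DecidableEq E] where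
  chord : Fin (2 * n) → E
  sign : E → Bool
  fiber_two : ∀ e : E, (Finset.univ.filter fun i => chord i = e).card = 2

namespace Bouquet

variable {n : ℕ} {E : Type} [Fintype E] [DecidableEq E]

/-- The partial Petrial `B^{×|A}`: same chord diagram, signs flipped exactly on `A`. -/
def petrial (B : Bouquet n E) (A : Finset E) : Bouquet n E where
  chord := B.chord
  sign := fun e => if e ∈ A then !B.sign e else B.sign e
  fiber_two := B.fiber_two

/-- The boundary graph on the `4*n` points `(i, b)` (with `b = true` meaning `i⁺` and
`b = false` meaning `i⁻`): the matching `σ` joins `i⁺` to `(i+1)⁻`, and the matching `τ`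
joins, for each chord with endpoints `{i, j}`, the points `i⁺,j⁻` and `i⁻,j⁺` when the
sign is `+1`, and the points `i⁺,j⁺` and `i⁻,j⁻` when the sign is `-1`. -/
def boundaryGraph (B : Bouquet n E) : SimpleGraph (Fin (2 * n) × Bool) :=
  SimpleGraph.fromRel fun x y =>
    (x.2 = true ∧ y.2 = false ∧ y.1.val = (x.1.val + 1) % (2 * n)) ∨
    (B.chord x.1 = B.chord y.1 ∧ x.1 ≠ y.1 ∧
      (if B.sign (B.chord x.1) then x.2 ≠ y.2 else x.2 = y.2))

/-- `f(B)`: the number of boundary components of `B`, i.e. the number of connected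
components of the boundary graph. -/
noncomputable def numBoundary (B : Bouquet n E) : ℕ :=
  Nat.card B.boundaryGraph.ConnectedComponent

/-- The Euler genus `ε(B) = n + 1 - f(B)`. -/
noncomputable def eulerGenus (B : Bouquet n E) : ℕ :=
  n + 1 - B.numBoundary

/-- The partial Petrial polynomial `∂ε^×_B(z) = Σ_{A ⊆ E} z^{ε(B^{×|A})}`. -/
noncomputable def petrialPoly (B : Bouquet n E) : Polynomial ℤ :=
  ∑ A : Finset E, Polynomial.X ^ (B.petrial A).eulerGenus

/-- Two distinct chords are interlaced if exactly one endpoint of the second lies in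
one of the two open arcs determined by the endpoints of the first (expressed here by
cutting the circle between positions `2*n - 1` and `0`). -/
def Interlaced (B : Bouquet n E) (e e' : E) : Prop :=
  e ≠ e' ∧ ∃ i j : Fin (2 * n), B.chord i = e ∧ B.chord j = e ∧ i < j ∧
    (Finset.univ.filter fun k => B.chord k = e' ∧ i < k ∧ k < j).card = 1

/-- The intersection graph `I(B)`: vertices are the chords, two chords adjacent iff
interlaced. -/
def intersectionGraph (B : Bouquet n E) : SimpleGraph E :=
  SimpleGraph.fromRel B.Interlaced

end Bouquet

namespace Bouquet

variable {n : ℕ} {E : Type} [Fintype E] [DecidableEq E]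

/-- `p e < q e` are the two endpoints of the chord `e`. -/
def IsEnds (B : Bouquet n E) (p q : E → Fin (2 * n)) : Prop :=
  ∀ e, p e < q e ∧ ∀ i, B.chord i = e ↔ i = p e ∨ i = q e

theorem exists_isEnds (B : Bouquet n E) : ∃ p q, B.IsEnds p q := by
  have h : ∀ e, ∃ p q : Fin (2 * n), p < q ∧ ∀ i, B.chord i = e ↔ i = p ∨ i = q := by
    intro e
    obtain ⟨a, b, hab, hs⟩ := Finset.card_eq_two.mp (B.fiber_two e)
    have hs' : ∀ i, B.chord i = e ↔ i = a ∨ i = b := fun i => by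
      simpa using Finset.ext_iff.mp hs i
    rcases lt_or_gt_of_ne hab with hlt | hlt
    · exact ⟨a, b, hlt, hs'⟩
    · exact ⟨b, a, hlt, fun i => (hs' i).trans or_comm⟩
  choose p q h using h
  exact ⟨p, q, h⟩

theorem card_chords (B : Bouquet n E) : Fintype.card E = n := by
  have h := Finset.card_eq_sum_card_fiberwise (f := B.chord) (s := Finset.univ)
    (t := Finset.univ) (fun _ _ => Finset.mem_coe.mpr (Finset.mem_univ _))
  simp only [B.fiber_two, Finset.card_univ, Fintype.card_fin, Finset.sum_const, smul_eq_mul] at h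
  omega

/-- The number modulo 2 of endpoints of `e'` strictly between the endpoints of `e`, plus one
if `e = e'` is twisted. -/
def parityMatrix (B : Bouquet n E) (p q : E → Fin (2 * n)) : Matrix E E (ZMod 2) :=
  fun e e' => ((Finset.univ.filter fun k => B.chord k = e' ∧ p e < k ∧ k < q e).card : ZMod 2) +
    if e = e' ∧ B.sign e = false then 1 else 0

/-- The sum of the chord weights `d` over all positions before `m`. -/
def prefixSum (B : Bouquet n E) (d : E → ZMod 2) (m : ℕ) : ZMod 2 :=
  ∑ k : Fin (2 * n) with k.val < m, d (B.chord k)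

/-- The labelling of boundary points with value `c` at `0⁻` which jumps by `d e` at each
endpoint of `e`. -/
def labelling (B : Bouquet n E) (c : ZMod 2) (d : E → ZMod 2) (x : Fin (2 * n) × Bool) : ZMod 2 :=
  c + B.prefixSum d (x.1.val + if x.2 then 1 else 0)

/-- A labelling of the boundary points is invariant if it is constant along boundary edges. -/
def IsInvariant (B : Bouquet n E) (g : Fin (2 * n) × Bool → ZMod 2) : Prop :=
  ∀ x y, B.boundaryGraph.Adj x y → g x = g y

variable {B : Bouquet n E} {p q : E → Fin (2 * n)}

theorem IsEnds.interlaced_iff_card (h : B.IsEnds p q) (e e' : E) :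
    B.Interlaced e e' ↔ e ≠ e' ∧
      (Finset.univ.filter fun k => B.chord k = e' ∧ p e < k ∧ k < q e).card = 1 := by
  refine and_congr_right fun _ => ⟨?_, fun hc => ⟨p e, q e, ?_, ?_, (h e).1, hc⟩⟩
  · rintro ⟨i, j, hi, hj, hij, hc⟩
    have := (h e).1
    rcases ((h e).2 i).mp hi with rfl | rfl <;> rcases ((h e).2 j).mp hj with rfl | rfl
    · exact absurd hij (lt_irrefl _)
    · exact hc
    · exact absurd hij this.not_gt
    · exact absurd hij (lt_irrefl _)
  · exact ((h e).2 _).mpr (Or.inl rfl)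
  · exact ((h e).2 _).mpr (Or.inr rfl)

theorem IsEnds.interlaced_iff (h : B.IsEnds p q) (e e' : E) :
    B.Interlaced e e' ↔ (p e < p e' ∧ p e' < q e ∧ q e < q e') ∨
      (p e' < p e ∧ p e < q e' ∧ q e' < q e) := by
  have hfilter : (Finset.univ.filter fun k => B.chord k = e' ∧ p e < k ∧ k < q e) =
      ({p e', q e'} : Finset _).filter fun k => p e < k ∧ k < q e := by
    ext k
    simp [(h e').2 k]
  have hne := (h e').1.ne
  rw [h.interlaced_iff_card, hfilter]
  have h1 := (h e).1
  have h2 := (h e').1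
  by_cases hee : e = e'
  · subst hee
    simp
  have hd : ∀ i j, B.chord i = e → B.chord j = e' → i ≠ j := by
    rintro i j hi hj rfl
    exact hee (hi.symm.trans hj)
  have hp := ((h e).2 (p e)).mpr (Or.inl rfl)
  have hq := ((h e).2 (q e)).mpr (Or.inr rfl)
  have hp' := ((h e').2 (p e')).mpr (Or.inl rfl)
  have hq' := ((h e').2 (q e')).mpr (Or.inr rfl)
  have n1 := hd _ _ hp hp'
  have n2 := hd _ _ hp hq'
  have n3 := hd _ _ hq hp'
  have n4 := hd _ _ hq hq'
  rw [and_iff_right hee, Finset.filter_insert, Finset.filter_singleton]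
  split_ifs
  · rw [Finset.card_pair hne]
    omega
  · rw [insert_empty_eq, Finset.card_singleton]
    omega
  · rw [Finset.card_singleton]
    omega
  · rw [Finset.card_empty]
    omega

theorem IsEnds.interlaced_symm (h : B.IsEnds p q) {e e' : E} (hi : B.Interlaced e e') :
    B.Interlaced e' e :=
  (h.interlaced_iff e' e).mpr ((h.interlaced_iff e e').mp hi).symm

theorem IsEnds.parityMatrix_self (h : B.IsEnds p q) (e : E) :
    B.parityMatrix p q e e = 1 ↔ B.sign e = false := by
  have : (Finset.univ.filter fun k => B.chord k = e ∧ p e < k ∧ k < q e) = ∅ := by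
    ext k
    simp only [Finset.mem_filter, Finset.mem_univ, true_and, Finset.notMem_empty, iff_false,
      (h e).2 k]
    rintro ⟨rfl | rfl, h1, h2⟩
    · exact lt_irrefl _ h1
    · exact lt_irrefl _ h2
  simp [parityMatrix, this]

theorem IsEnds.parityMatrix_of_ne (h : B.IsEnds p q) {e e' : E} (hee : e ≠ e') :
    B.parityMatrix p q e e' = 1 ↔ B.Interlaced e e' := by
  have hle : (Finset.univ.filter fun k => B.chord k = e' ∧ p e < k ∧ k < q e).card ≤ 2 :=
    (Finset.card_le_card (Finset.monotone_filter_right _ fun _ _ hk => hk.1)).trans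
      (B.fiber_two e').le
  rw [h.interlaced_iff_card, and_iff_right hee]
  simp only [parityMatrix, hee, false_and, if_false, add_zero]
  generalize (Finset.univ.filter fun k => B.chord k = e' ∧ p e < k ∧ k < q e).card = m at hle
  interval_cases m <;> decide

theorem prefixSum_succ (d : E → ZMod 2) (i : Fin (2 * n)) :
    B.prefixSum d (i.val + 1) = B.prefixSum d i.val + d (B.chord i) := by
  have : (Finset.univ.filter fun k : Fin (2 * n) => k.val < i.val + 1) =
      insert i (Finset.univ.filter fun k : Fin (2 * n) => k.val < i.val) := by
    ext k
    simp only [Finset.mem_filter, Finset.mem_univ, true_and, Finset.mem_insert, Fin.ext_iff]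
    omega
  rw [prefixSum, this, Finset.sum_insert (by simp), prefixSum, add_comm]

@[simp] theorem prefixSum_zero (d : E → ZMod 2) : B.prefixSum d 0 = 0 := by
  simp [prefixSum]

theorem prefixSum_total (d : E → ZMod 2) : B.prefixSum d (2 * n) = 0 := by
  have : (Finset.univ.filter fun k : Fin (2 * n) => k.val < 2 * n) = Finset.univ := by
    simp
  rw [prefixSum, this, ← Finset.sum_fiberwise Finset.univ B.chord]
  refine Finset.sum_eq_zero fun e _ => ?_
  rw [Finset.sum_congr rfl (g := fun _ => d e)
    (fun k hk => by rw [(Finset.mem_filter.mp hk).2]), Finset.sum_const, B.fiber_two, two_nsmul,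
    CharTwo.add_self_eq_zero]

theorem IsEnds.parityMatrix_mulVec (h : B.IsEnds p q) (d : E → ZMod 2) (e : E) :
    (B.parityMatrix p q).mulVec d e = B.prefixSum d (p e + 1) + B.prefixSum d (q e) +
      if B.sign e = false then d e else 0 := by
  have hpq := (h e).1
  have hsplit : B.prefixSum d (q e) = B.prefixSum d (p e + 1) +
      ∑ k with p e < k ∧ k < q e, d (B.chord k) := by
    rw [prefixSum, prefixSum, ← Finset.sum_union]
    · refine Finset.sum_congr ?_ fun _ _ => rfl
      ext k
      simp only [Finset.mem_filter, Finset.mem_univ, true_and, Finset.mem_union]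
      omega
    · rw [Finset.disjoint_left]
      intro k
      simp only [Finset.mem_filter, Finset.mem_univ, true_and]
      omega
  rw [hsplit, ← add_assoc, CharTwo.add_self_eq_zero, zero_add,
    ← Finset.sum_fiberwise _ B.chord]
  simp only [Matrix.mulVec, dotProduct, parityMatrix, add_mul, Finset.sum_add_distrib]
  congr 1
  · refine Finset.sum_congr rfl fun e' _ => ?_
    rw [Finset.sum_congr rfl (g := fun _ => d e')
      (fun k hk => by rw [(Finset.mem_filter.mp hk).2]), Finset.sum_const, Finset.filter_filter,
      nsmul_eq_mul]
    simp only [and_comm]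
  · by_cases hs : B.sign e = false <;> simp [hs]

theorem IsEnds.isInvariant_iff (h : B.IsEnds p q) (g : Fin (2 * n) × Bool → ZMod 2) :
    B.IsInvariant g ↔
      (∀ i j : Fin (2 * n), j.val = (i.val + 1) % (2 * n) → g (i, true) = g (j, false)) ∧
      ∀ e b, g (p e, b) = g (q e, if B.sign e then !b else b) := by
  have hp e := ((h e).2 (p e)).mpr (Or.inl rfl)
  have hq e := ((h e).2 (q e)).mpr (Or.inr rfl)
  constructor
  · intro hg
    refine ⟨fun i j hij => hg _ _ ?_, fun e b => hg _ _ ?_⟩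
    · exact (SimpleGraph.fromRel_adj _ _ _).mpr ⟨by simp, Or.inl (Or.inl ⟨rfl, rfl, hij⟩)⟩
    · refine (SimpleGraph.fromRel_adj _ _ _).mpr
        ⟨fun hc => (h e).1.ne (congrArg Prod.fst hc), Or.inl (Or.inr ⟨?_, (h e).1.ne, ?_⟩)⟩
      · exact (hp e).trans (hq e).symm
      · simp only [hp]
        cases B.sign e <;> simp
  · rintro ⟨hσ, hτ⟩
    have key : ∀ x y : Fin (2 * n) × Bool,
        (x.2 = true ∧ y.2 = false ∧ y.1.val = (x.1.val + 1) % (2 * n)) ∨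
        (B.chord x.1 = B.chord y.1 ∧ x.1 ≠ y.1 ∧
          (if B.sign (B.chord x.1) then x.2 ≠ y.2 else x.2 = y.2)) → g x = g y := by
      rintro ⟨i, a⟩ ⟨j, b⟩ (⟨rfl, rfl, hij⟩ | ⟨hc, hne, hs⟩)
      · exact hσ i j hij
      · dsimp only at hc hne hs
        generalize he : B.chord i = e at hc hs
        have h1 := hτ e a
        have h2 := hτ e b
        rcases ((h e).2 i).mp he with rfl | rfl <;>
          rcases ((h e).2 j).mp hc.symm with rfl | rfl
        · exact absurd rfl hne
        · rw [h1]
          congr 2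
          revert hs
          cases B.sign e <;> cases a <;> cases b <;> simp
        · rw [h2]
          congr 2
          revert hs
          cases B.sign e <;> cases a <;> cases b <;> simp
        · exact absurd rfl hne
    intro x y hxy
    rcases ((SimpleGraph.fromRel_adj _ _ _).mp hxy).2 with hr | hr
    · exact key x y hr
    · exact (key y x hr).symm

theorem IsEnds.isInvariant_labelling_iff (h : B.IsEnds p q) (c : ZMod 2) (d : E → ZMod 2) :
    B.IsInvariant (B.labelling c d) ↔ (B.parityMatrix p q).mulVec d = 0 := by
  rw [h.isInvariant_iff, funext_iff]
  have hσ : ∀ i j : Fin (2 * n), j.val = (i.val + 1) % (2 * n) →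
      B.labelling c d (i, true) = B.labelling c d (j, false) := by
    intro i j hij
    simp only [labelling, if_true, Bool.false_eq_true, if_false, add_zero]
    rcases Nat.lt_or_ge (i.val + 1) (2 * n) with hi | hi
    · rw [hij, Nat.mod_eq_of_lt hi]
    · have : i.val + 1 = 2 * n := by omega
      rw [hij, this, Nat.mod_self, prefixSum_total, prefixSum_zero]
  rw [and_iff_right hσ]
  refine forall_congr' fun e => ?_
  have hp := ((h e).2 (p e)).mpr (Or.inl rfl)
  have hq := ((h e).2 (q e)).mpr (Or.inr rfl)
  rw [h.parityMatrix_mulVec]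
  simp only [labelling, Bool.forall_bool, Pi.zero_apply, add_right_inj]
  cases B.sign e <;> simp [prefixSum_succ, hp, hq] <;>
    generalize B.prefixSum d _ = a <;> generalize B.prefixSum d _ = b <;> generalize d e = x <;>
    revert a b x <;> decide

theorem IsEnds.eq_labelling (h : B.IsEnds p q) {g : Fin (2 * n) × Bool → ZMod 2}
    (hg : B.IsInvariant g) (h0 : 0 < 2 * n) :
    B.labelling (g (⟨0, h0⟩, false)) (fun e => g (p e, true) + g (p e, false)) = g := by
  obtain ⟨hσ, hτ⟩ := (h.isInvariant_iff g).mp hg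
  have hjump : ∀ i, g (i, true) = g (i, false) +
      (g (p (B.chord i), true) + g (p (B.chord i), false)) := by
    intro i
    generalize he : B.chord i = e
    have h1 := hτ e true
    have h2 := hτ e false
    rcases ((h e).2 i).mp he with rfl | rfl
    · rw [add_comm, add_assoc, CharTwo.add_self_eq_zero, add_zero]
    · rw [h1, h2]
      cases B.sign e <;> simp <;> generalize g (q e, true) = a <;>
        generalize g (q e, false) = b <;> revert a b <;> decide
  have hminus : ∀ m (hm : m < 2 * n), g (⟨0, h0⟩, false) +
      B.prefixSum (fun e => g (p e, true) + g (p e, false)) m = g (⟨m, hm⟩, false) := by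
    intro m
    induction m with
    | zero => simp
    | succ m ih =>
      intro hm
      have hm' : m < 2 * n := by omega
      rw [prefixSum_succ _ ⟨m, hm'⟩, ← add_assoc, ih hm', ← hjump]
      exact hσ _ _ (by simp [Nat.mod_eq_of_lt hm])
  funext ⟨i, b⟩
  cases b
  · simpa [labelling] using hminus i.val i.isLt
  · simp only [labelling, if_true]
    rw [prefixSum_succ, ← add_assoc, hminus i.val i.isLt, ← hjump]

theorem IsEnds.labelling_injective (h : B.IsEnds p q) (hn : 0 < 2 * n) {c c' : ZMod 2}
    {d d' : E → ZMod 2} (hl : B.labelling c d = B.labelling c' d') : c = c' ∧ d = d' := by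
  have h0 := congrFun hl (⟨0, hn⟩, false)
  simp only [labelling, Bool.false_eq_true, if_false, add_zero, prefixSum_zero] at h0
  subst h0
  refine ⟨rfl, funext fun e => ?_⟩
  have h1 := congrFun hl (p e, false)
  have h2 := congrFun hl (p e, true)
  simp only [labelling, Bool.false_eq_true, if_false, if_true, add_zero, prefixSum_succ,
    add_right_inj, ((h e).2 (p e)).mpr (Or.inl rfl)] at h1 h2
  rwa [h1, add_right_inj] at h2

theorem card_isInvariant (B : Bouquet n E) :
    Nat.card {g // B.IsInvariant g} = 2 ^ B.numBoundary := by
  have hbij : Function.Bijective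
      (fun φ : B.boundaryGraph.ConnectedComponent → ZMod 2 =>
        (⟨fun x => φ (B.boundaryGraph.connectedComponentMk x), fun x y hxy =>
          congrArg φ (SimpleGraph.ConnectedComponent.sound hxy.reachable)⟩ :
          {g // B.IsInvariant g})) := by
    constructor
    · intro φ ψ hφ
      funext C
      induction C using SimpleGraph.ConnectedComponent.ind with
      | h v => exact congrFun (congrArg Subtype.val hφ) v
    · rintro ⟨g, hg⟩
      refine ⟨SimpleGraph.ConnectedComponent.lift g fun v w t _ => ?_, rfl⟩
      induction t with
      | nil => rfl
      | cons hadj _ ih => exact (hg _ _ hadj).trans (ih (by simp_all))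
  rw [← Nat.card_congr (Equiv.ofBijective _ hbij), Nat.card_fun, Nat.card_zmod, numBoundary]

theorem IsEnds.numBoundary_add_rank (h : B.IsEnds p q) (hn : 0 < n) :
    B.numBoundary + (B.parityMatrix p q).rank = n + 1 := by
  have h0 : 0 < 2 * n := by omega
  let K := LinearMap.ker (B.parityMatrix p q).mulVecLin
  have hmem : ∀ d, d ∈ K ↔ (B.parityMatrix p q).mulVec d = 0 := fun d => LinearMap.mem_ker
  have hbij : Function.Bijective (fun x : ZMod 2 × K =>
      (⟨B.labelling x.1 x.2.1, (h.isInvariant_labelling_iff _ _).mpr ((hmem _).mp x.2.2)⟩ :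
        {g // B.IsInvariant g})) := by
    constructor
    · rintro ⟨c, d, hd⟩ ⟨c', d', hd'⟩ heq
      obtain ⟨rfl, rfl⟩ := h.labelling_injective h0 (congrArg Subtype.val heq)
      rfl
    · rintro ⟨g, hg⟩
      have heq := h.eq_labelling hg h0
      exact ⟨⟨_, _, (hmem _).mpr ((h.isInvariant_labelling_iff _ _).mp (heq ▸ hg))⟩,
        Subtype.ext heq⟩
  have hcard := Nat.card_congr (Equiv.ofBijective _ hbij)
  rw [card_isInvariant, Nat.card_prod, Nat.card_zmod, Module.natCard_eq_pow_finrank (K := ZMod 2),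
    Nat.card_zmod, ← pow_succ'] at hcard
  have hf : B.numBoundary = Module.finrank (ZMod 2) (B.parityMatrix p q).mulVecLin.ker + 1 :=
    Nat.pow_right_injective le_rfl hcard.symm
  have hrank := (B.parityMatrix p q).mulVecLin.finrank_range_add_finrank_ker
  rw [Module.finrank_fintype_fun_eq_card, B.card_chords] at hrank
  rw [Matrix.rank]
  omega

end Bouquet

theorem Matrix.row_eq_of_rank_eq_one {m k : Type*} [Fintype m] [Fintype k]
    {A : Matrix m k (ZMod 2)} (hA : A.rank = 1) {i j : m} (hi : A i ≠ 0) (hj : A j ≠ 0) :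
    A i = A j := by
  rw [Matrix.rank_eq_finrank_span_row, finrank_eq_one_iff'] at hA
  obtain ⟨v, -, hv⟩ := hA
  have key : ∀ r, A r ≠ 0 → A r = v := by
    intro r hr
    obtain ⟨c, hc⟩ := hv ⟨A r, Submodule.subset_span ⟨r, rfl⟩⟩
    have hc' : c • (v : k → ZMod 2) = A r := congrArg Subtype.val hc
    have h01 : c = 0 ∨ c = 1 := by
      clear hc hc'
      revert c
      decide
    rcases h01 with rfl | rfl
    · exact absurd (by rw [← hc', zero_smul]) hr
    · rw [← hc', one_smul]
  rw [key i hi, key j hj]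

/-- For a prime bouquet on `n ≥ 2` chords, `f(B) = n` iff every pair of distinct chords
is interlaced and every chord is twisted (i.e. `B = [e₁,…,e_n,−e₁,…,−e_n]`). -/
theorem stmt7 {n : ℕ} (hn : 2 ≤ n) {E : Type} [Fintype E] [DecidableEq E]
    (B : Bouquet n E) (hprime : B.intersectionGraph.Connected) :
    B.numBoundary = n ↔
      ((∀ e e' : E, e ≠ e' → B.Interlaced e e') ∧ ∀ e : E, B.sign e = false) := by
  obtain ⟨p, q, h⟩ := B.exists_isEnds
  have hcard := B.card_chords
  have hrank := h.numBoundary_add_rank (by omega)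
  have hiff : B.numBoundary = n ↔ (B.parityMatrix p q).rank = 1 := by omega
  rw [hiff]
  have : Nontrivial E := Fintype.one_lt_card_iff_nontrivial.mp (by omega)
  constructor
  · intro hr
    have hnbr : ∀ e, ∃ e', e ≠ e' ∧ B.Interlaced e e' := by
      intro e
      obtain ⟨e', he'⟩ := hprime.preconnected.exists_adj_of_nontrivial e
      obtain ⟨hne, hi | hi⟩ := (SimpleGraph.fromRel_adj _ _ _).mp he'
      · exact ⟨e', hne, hi⟩
      · exact ⟨e', hne, h.interlaced_symm hi⟩
    have hrow : ∀ e, B.parityMatrix p q e ≠ 0 := by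
      intro e h0
      obtain ⟨e', hne, hi⟩ := hnbr e
      have h1 := (h.parityMatrix_of_ne hne).mpr hi
      rw [h0] at h1
      exact zero_ne_one h1
    have heq : ∀ a b c, B.parityMatrix p q a c = B.parityMatrix p q b c := fun a b c =>
      congrFun (Matrix.row_eq_of_rank_eq_one hr (hrow a) (hrow b)) c
    have hdiag : ∀ e, B.parityMatrix p q e e = 1 := by
      intro e
      obtain ⟨e', hne, hi⟩ := hnbr e
      rw [heq e e' e]
      exact (h.parityMatrix_of_ne hne.symm).mpr (h.interlaced_symm hi)
    exact ⟨fun e e' hne => (h.parityMatrix_of_ne hne).mp ((heq e e' e').trans (hdiag e')),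
      fun e => (h.parityMatrix_self e).mp (hdiag e)⟩
  · rintro ⟨hall, hsign⟩
    have hone : B.parityMatrix p q = Matrix.vecMulVec (fun _ => 1) (fun _ => 1) := by
      ext e e'
      rw [Matrix.vecMulVec_apply, mul_one]
      by_cases hne : e = e'
      · subst hne
        exact (h.parityMatrix_self e).mpr (hsign e)
      · exact (h.parityMatrix_of_ne hne).mpr (hall e e' hne)
    have hle : (B.parityMatrix p q).rank ≤ 1 := hone ▸ Matrix.rank_vecMulVec_le _ _
    have hne : (B.parityMatrix p q).rank ≠ 0 := by
      rw [Ne, Matrix.rank, Submodule.finrank_eq_zero, LinearMap.range_eq_bot]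
      intro h0
      obtain ⟨e⟩ := hprime.nonempty
      have h1 := congrFun (LinearMap.congr_fun h0 (Pi.single e 1)) e
      rw [Matrix.mulVecLin_apply, Matrix.mulVec_single_one, Matrix.col_apply,
        (h.parityMatrix_self e).mpr (hsign e)] at h1
      exact one_ne_zero h1
    omega
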